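/- Let T be a tree of order n ≥ 4 with maximum degree at least 3. Then hc(T) = (n−1)(n−1−ζ(T)) + ζ'(T) − 2L_W(T) holds if and only if there exists an ordering x_0, x_1, …, x_{n−1} of the vertices of T, with L(x_0) = 0 and L(x_{n−1}) = 1 when T has one weight center, and L(x_0) = L(x_{n−1}) = 0 when T has two weight centers, such that for all 0 ≤ i < j ≤ n−1, D(x_i,x_j) ≥ Σ_{t=i}^{j−1} (L(x_t) + L(x_{t+1})) − (j−i)(n−1−ζ(T)) + (n−1). Moreover, under this condition the mapping h defined by h(x_0) = 0 and h(x_{i+1}) = h(x_i) + n − 1 − ζ(T) − L(x_i) − L(x_{i+1}) for 0 ≤ i ≤ n−2 is an optimal hamiltonian coloring of T (i.e., a hamiltonian coloring with span equal to hc(T)). -/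

import Mathlib

open SimpleGraph Finset

namespace HCPaper

variable {V : Type*}

/-- The detour distance `D(u,v)`: the length of a longest `u`–`v` path. -/
noncomputable def detourDist (G : SimpleGraph V) (u v : V) : ℕ :=
  sSup {n | ∃ p : G.Walk u v, p.IsPath ∧ p.length = n}

/-- A hamiltonian coloring: `D(u,v) + |h u - h v| ≥ n - 1` for all distinct `u, v`. -/
def IsHamiltonianColoring [Fintype V] (G : SimpleGraph V) (h : V → ℕ) : Prop :=
  ∀ u v : V, u ≠ v →
    Fintype.card V - 1 ≤ detourDist G u v + Nat.dist (h u) (h v)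

/-- The span of a coloring: the maximum of `|h u - h v|`. -/
noncomputable def spanOf (h : V → ℕ) : ℕ :=
  sSup (Set.range fun p : V × V => Nat.dist (h p.1) (h p.2))

/-- The hamiltonian chromatic number: minimum span over hamiltonian colorings. -/
noncomputable def hc [Fintype V] (G : SimpleGraph V) : ℕ :=
  sInf {s | ∃ h : V → ℕ, IsHamiltonianColoring G h ∧ spanOf h = s}

/-- The weight of the graph from a vertex `v`. -/
noncomputable def treeWeight [Fintype V] (G : SimpleGraph V) (v : V) : ℕ :=
  ∑ u, G.dist u v

/-- The set of weight centers. -/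
def WeightCenters [Fintype V] (G : SimpleGraph V) : Set V :=
  {v | ∀ u, treeWeight G v ≤ treeWeight G u}

/-- The detour level `L(u) = min {d(u,w) : w ∈ W(T)}`. -/
noncomputable def detourLevel [Fintype V] (G : SimpleGraph V) (u : V) : ℕ :=
  sInf {k | ∃ w ∈ WeightCenters G, G.dist u w = k}

/-- The total detour level `L_W(T) = ∑ L(u)`. -/
noncomputable def totalDetourLevel [Fintype V] (G : SimpleGraph V) : ℕ :=
  ∑ u, detourLevel G u

/-- `ζ(T)` : 0 if one weight center, 1 if two. -/
noncomputable def zeta [Fintype V] (G : SimpleGraph V) : ℕ :=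
  if (WeightCenters G).ncard = 2 then 1 else 0

/-- `ζ'(T) = 1 - ζ(T)`. -/
noncomputable def zeta' [Fintype V] (G : SimpleGraph V) : ℕ := 1 - zeta G

/-- `t` is an ancestor of `v` : `t` lies on the path joining the nearest weight center and `v`. -/
def IsAncestor [Fintype V] (G : SimpleGraph V) (t v : V) : Prop :=
  ∃ w ∈ WeightCenters G, G.dist v w = detourLevel G v ∧
    ∃ p : G.Walk w v, p.IsPath ∧ t ∈ p.support

/-- `φ(u,v)`: maximum detour level of a common ancestor of `u` and `v`. -/
noncomputable def phi [Fintype V] (G : SimpleGraph V) (u v : V) : ℕ :=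
  sSup {k | ∃ t, IsAncestor G t u ∧ IsAncestor G t v ∧ detourLevel G t = k}

open Classical in
/-- `δ(u,v)`: 1 if there are two weight centers `w, w'` and the `u`–`v` path contains
the edge `ww'`, 0 otherwise. -/
noncomputable def delta [Fintype V] (G : SimpleGraph V) (u v : V) : ℕ :=
  if ∃ w w', w ≠ w' ∧ WeightCenters G = {w, w'} ∧
      ∃ p : G.Walk u v, p.IsPath ∧ s(w, w') ∈ p.edges
  then 1 else 0

/-- `u` and `v` lie in different branches: branches at two distinct vertices adjacent to
the same weight center. -/
def InDifferentBranches [Fintype V] (G : SimpleGraph V) (u v : V) : Prop :=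
  ∃ w b₁ b₂, w ∈ WeightCenters G ∧ b₁ ≠ b₂ ∧
    b₁ ∉ WeightCenters G ∧ b₂ ∉ WeightCenters G ∧
    G.Adj w b₁ ∧ G.Adj w b₂ ∧ IsAncestor G b₁ u ∧ IsAncestor G b₂ v

/-- `u` and `v` lie in opposite branches: branches at vertices adjacent to different
weight centers. -/
def InOppositeBranches [Fintype V] (G : SimpleGraph V) (u v : V) : Prop :=
  ∃ w₁ w₂ b₁ b₂, w₁ ∈ WeightCenters G ∧ w₂ ∈ WeightCenters G ∧ w₁ ≠ w₂ ∧
    b₁ ∉ WeightCenters G ∧ b₂ ∉ WeightCenters G ∧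
    G.Adj w₁ b₁ ∧ G.Adj w₂ b₂ ∧ IsAncestor G b₁ u ∧ IsAncestor G b₂ v

/-- The eccentricity of a vertex. -/
noncomputable def ecc (G : SimpleGraph V) (v : V) : ℕ :=
  sSup (Set.range fun u => G.dist v u)

/-- The center of a graph: vertices of minimum eccentricity. -/
def graphCenter (G : SimpleGraph V) : Set V :=
  {v | ∀ u, ecc G v ≤ ecc G u}

/-- The total level with respect to the center `C(T)`. -/
noncomputable def totalLevel [Fintype V] (G : SimpleGraph V) : ℕ :=
  ∑ u, sInf {k | ∃ x ∈ graphCenter G, G.dist u x = k}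

/-- `ε(T)` : 0 if the center has one vertex, 1 if two. -/
noncomputable def eps [Fintype V] (G : SimpleGraph V) : ℕ :=
  if (graphCenter G).ncard = 2 then 1 else 0

/-- `ε'(T) = 1 - ε(T)`. -/
noncomputable def eps' [Fintype V] (G : SimpleGraph V) : ℕ := 1 - eps G

/-- The weight-center based lower bound `lb_W(T)`. -/
noncomputable def lbW [Fintype V] (G : SimpleGraph V) : ℤ :=
  ((Fintype.card V : ℤ) - 1) * ((Fintype.card V : ℤ) - 1 - zeta G) +
    zeta' G - 2 * totalDetourLevel G

/-- The center based lower bound `lb(T)`. -/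
noncomputable def lbC [Fintype V] (G : SimpleGraph V) : ℤ :=
  ((Fintype.card V : ℤ) - 1) * ((Fintype.card V : ℤ) - 1 - eps G) +
    eps' G - 2 * totalLevel G

/-- The broom `B_{n,d}`: a path on vertices `0, …, d-1` together with `n - d` pendant
vertices all adjacent to the end vertex `d-1` of the path. -/
def broom (n d : ℕ) : SimpleGraph (Fin n) :=
  SimpleGraph.fromRel (fun i j =>
    (i.val + 1 = j.val ∧ j.val < d) ∨ (i.val + 1 = d ∧ d ≤ j.val))

/-- The star `K_{1,n-1}`: vertex `0` adjacent to the `n - 1` other vertices. -/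
def starGraph (n : ℕ) : SimpleGraph (Fin n) :=
  SimpleGraph.fromRel (fun i _ => i.val = 0)

/-- The caterpillar `C(m,d)`: a spine `v_1, …, v_m` with `d - 2` legs attached to each
inner spine vertex `v_2, …, v_{m-1}` (so each inner spine vertex has degree `d`). -/
def caterpillar (m d : ℕ) : SimpleGraph (Fin m ⊕ Fin (m - 2) × Fin (d - 2)) :=
  SimpleGraph.fromRel (fun x y =>
    (∃ i j : Fin m, x = Sum.inl i ∧ y = Sum.inl j ∧ i.val + 1 = j.val) ∨
    (∃ i : Fin m, ∃ a : Fin (m - 2), ∃ b : Fin (d - 2),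
      x = Sum.inl i ∧ y = Sum.inr (a, b) ∧ i.val = a.val + 1))


/-! ### Trees -/

lemma detourDist_eq_dist {G : SimpleGraph V} (hT : G.IsTree) (u v : V) :
    detourDist G u v = G.dist u v := by
  obtain ⟨p, hp, hl⟩ := hT.connected.exists_path_of_dist u v
  have : {n | ∃ p : G.Walk u v, p.IsPath ∧ p.length = n} = {G.dist u v} := by
    ext n
    constructor
    · rintro ⟨q, hq, rfl⟩
      rw [(hT.existsUnique_path u v).unique hq hp]
      exact hl
    · rintro rfl
      exact ⟨p, hp, hl⟩
  rw [detourDist, this, csSup_singleton]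

/-- In a tree, a vertex has at most one neighbor closer to a given root. -/
lemma eq_of_adj_of_dist_lt {G : SimpleGraph V} (hT : G.IsTree) {r a b c : V}
    (hab : G.Adj a b) (hcb : G.Adj c b) (ha : G.dist r a < G.dist r b)
    (hc : G.dist r c < G.dist r b) : a = c := by
  have key : ∀ d : V, G.Adj d b → G.dist r d < G.dist r b →
      ∃ p : G.Walk r b, p.IsPath ∧ p.penultimate = d := by
    intro d hd hlt
    obtain ⟨p, hp⟩ := hT.connected.exists_walk_length_eq_dist r d
    refine ⟨p.concat hd, ?_, by simp⟩
    apply Walk.isPath_of_length_eq_dist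
    have := dist_le (p.concat hd)
    rw [Walk.length_concat] at *
    omega
  obtain ⟨p, hp, rfl⟩ := key a hab ha
  obtain ⟨q, hq, rfl⟩ := key c hcb hc
  rw [(hT.existsUnique_path r b).unique hp hq]

/-- Convexity of the distance to a fixed vertex along paths of a tree. -/
lemma two_mul_dist_le {G : SimpleGraph V} (hT : G.IsTree) {a b c : V}
    (hab : G.Adj a b) (hcb : G.Adj c b) (hac : a ≠ c) (r : V) :
    2 * G.dist r b ≤ G.dist r a + G.dist r c := by
  have h1 := hT.dist_eq_dist_add_one_of_adj r hab
  have h2 := hT.dist_eq_dist_add_one_of_adj r hcb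
  by_contra hlt
  exact hac (eq_of_adj_of_dist_lt hT (r := r) hab hcb (by omega) (by omega))

lemma two_mul_treeWeight_lt [Fintype V] {G : SimpleGraph V} (hT : G.IsTree) {a b c : V}
    (hab : G.Adj a b) (hcb : G.Adj c b) (hac : a ≠ c) :
    2 * treeWeight G b < treeWeight G a + treeWeight G c := by
  unfold treeWeight
  rw [mul_sum, ← sum_add_distrib]
  apply sum_lt_sum
  · exact fun u _ => two_mul_dist_le hT hab hcb hac u
  · refine ⟨b, mem_univ _, ?_⟩
    have := hT.connected.pos_dist_of_ne hab.ne'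
    simp only [dist_self]
    omega

lemma adj_of_mem_weightCenters [Fintype V] {G : SimpleGraph V} (hT : G.IsTree) {w w' : V}
    (hw : w ∈ WeightCenters G) (hw' : w' ∈ WeightCenters G) (hne : w ≠ w') : G.Adj w w' := by
  obtain ⟨p, hp, -⟩ := hT.connected.exists_path_of_dist w w'
  have hpos : p.length ≠ 0 := fun h => hne (Walk.eq_of_length_eq_zero h)
  by_contra hadj
  have hone : p.length ≠ 1 := fun h => hadj (Walk.adj_of_length_eq_one h)
  have step : ∀ i, i + 2 ≤ p.length →
      treeWeight G (p.getVert (i + 1)) < treeWeight G (p.getVert (i + 2)) := by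
    intro i
    induction i with
    | zero =>
      intro hi
      have h := two_mul_treeWeight_lt hT (p.adj_getVert_succ (i := 0) (by omega))
        (p.adj_getVert_succ (i := 1) (by omega)).symm
        (fun h => absurd (hp.getVert_injOn (by simp) (by simpa using hi) h) (by omega))
      have := hw (p.getVert 1)
      simp only [Walk.getVert_zero, zero_add, Nat.reduceAdd] at *
      omega
    | succ i ih =>
      intro hi
      have h := two_mul_treeWeight_lt hT (p.adj_getVert_succ (i := i + 1) (by omega))
        (p.adj_getVert_succ (i := i + 2) (by omega)).symm
        (fun h => absurd (hp.getVert_injOn (by simp; omega) (by simp; omega) h) (by omega))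
      have := ih (by omega)
      simp only [add_assoc, Nat.reduceAdd] at *
      omega
  have h := step (p.length - 2) (by omega)
  rw [show p.length - 2 + 2 = p.length by omega, Walk.getVert_length] at h
  exact absurd (hw' (p.getVert (p.length - 2 + 1))) (by omega)

lemma weightCenters_eq_singleton_or_pair [Fintype V] {G : SimpleGraph V} (hT : G.IsTree) :
    (∃ w, WeightCenters G = {w}) ∨ ∃ w w', G.Adj w w' ∧ WeightCenters G = {w, w'} := by
  have := hT.connected.nonempty
  obtain ⟨w, hw⟩ := Finite.exists_min (treeWeight G)
  by_cases h : ∃ w' ∈ WeightCenters G, w' ≠ w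
  · obtain ⟨w', hw', hne⟩ := h
    have hadj := adj_of_mem_weightCenters hT hw hw' hne.symm
    refine Or.inr ⟨w, w', hadj, Set.Subset.antisymm ?_ ?_⟩
    · intro z hz
      by_contra hz'
      simp only [Set.mem_insert_iff, Set.mem_singleton_iff, not_or] at hz'
      have h1 := adj_of_mem_weightCenters hT hz hw hz'.1
      have h2 := adj_of_mem_weightCenters hT hz hw' hz'.2
      have h3 := hT.dist_ne_of_adj z hadj
      rw [dist_eq_one_iff_adj.2 h1, dist_eq_one_iff_adj.2 h2] at h3
      exact h3 rfl
    · rintro z (rfl | rfl)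
      exacts [hw, hw']
  · push Not at h
    exact Or.inl ⟨w, Set.Subset.antisymm h (Set.singleton_subset_iff.2 hw)⟩

lemma exists_dist_eq_detourLevel [Fintype V] {G : SimpleGraph V} (hT : G.IsTree) (u : V) :
    ∃ w ∈ WeightCenters G, G.dist u w = detourLevel G u := by
  refine Nat.sInf_mem (s := {k | ∃ w ∈ WeightCenters G, G.dist u w = k}) ?_
  have := hT.connected.nonempty
  obtain ⟨w, hw⟩ := Finite.exists_min (treeWeight G)
  exact ⟨_, w, hw, rfl⟩

lemma zeta_cases [Fintype V] {G : SimpleGraph V} (hT : G.IsTree) :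
    ((WeightCenters G).ncard = 1 ∧ zeta G = 0 ∧ zeta' G = 1) ∨
      ((WeightCenters G).ncard = 2 ∧ zeta G = 1 ∧ zeta' G = 0) := by
  unfold zeta' zeta
  rcases weightCenters_eq_singleton_or_pair hT with ⟨w, hw⟩ | ⟨w, w', hadj, hw⟩
  · simp [hw]
  · simp [hw, Set.ncard_pair hadj.ne]

lemma dist_le_detourLevel_add [Fintype V] {G : SimpleGraph V} (hT : G.IsTree) (u v : V) :
    G.dist u v ≤ detourLevel G u + detourLevel G v + zeta G := by
  obtain ⟨a, ha, hua⟩ := exists_dist_eq_detourLevel hT u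
  obtain ⟨b, hb, hvb⟩ := exists_dist_eq_detourLevel hT v
  have h1 := hT.connected.dist_triangle (u := u) (v := a) (w := v)
  have h2 := hT.connected.dist_triangle (u := a) (v := b) (w := v)
  have h3 : G.dist a b ≤ zeta G := by
    by_cases hab : a = b
    · simp [hab]
    · rw [dist_eq_one_iff_adj.2 (adj_of_mem_weightCenters hT ha hb hab)]
      rcases zeta_cases hT with ⟨h, -⟩ | ⟨-, h, -⟩
      · obtain ⟨w, hw⟩ := Set.ncard_eq_one.1 h
        rw [hw] at ha hb
        exact absurd (ha.trans hb.symm) hab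
      · omega
  rw [dist_comm (u := b)] at h2
  omega

lemma zeta'_le_detourLevel_add [Fintype V] {G : SimpleGraph V} (hT : G.IsTree) {u v : V}
    (huv : u ≠ v) : zeta' G ≤ detourLevel G u + detourLevel G v := by
  rcases zeta_cases hT with ⟨h, -, hz⟩ | ⟨-, -, hz⟩
  · obtain ⟨w, hw⟩ := Set.ncard_eq_one.1 h
    by_contra hlt
    obtain ⟨a, ha, hua⟩ := exists_dist_eq_detourLevel hT u
    obtain ⟨b, hb, hvb⟩ := exists_dist_eq_detourLevel hT v
    rw [hw, Set.mem_singleton_iff] at ha hb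
    subst ha hb
    have h1 := (hT.connected.dist_eq_zero_iff (u := u) (v := b)).1 (by omega)
    have h2 := (hT.connected.dist_eq_zero_iff (u := v) (v := b)).1 (by omega)
    exact huv (h1.trans h2.symm)
  · omega

/-- A tree with a vertex of degree at least three has no hamiltonian path. -/
lemma dist_add_one_lt_card [Fintype V] {G : SimpleGraph V} (hT : G.IsTree)
    (hdeg : ∃ v, 3 ≤ (G.neighborSet v).ncard) (u v : V) :
    G.dist u v + 1 < Fintype.card V := by
  obtain ⟨p, hp, hl⟩ := hT.connected.exists_path_of_dist u v
  refine lt_of_le_of_ne (hl ▸ hp.length_lt) fun heq => ?_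
  have hsurj : Set.SurjOn (G.dist u) (univ : Finset V)
      (range (Fintype.card V) : Finset ℕ) := by
    intro k hk
    have hk : k < Fintype.card V := by simpa using hk
    refine ⟨p.getVert k, by simp, ?_⟩
    have h1 := dist_le (p.take k)
    have h2 := dist_le (p.drop k)
    have h3 := hT.connected.dist_triangle (u := u) (v := p.getVert k) (w := v)
    rw [Walk.take_length] at h1
    rw [Walk.drop_length] at h2
    omega
  have hinj := injOn_of_surjOn_of_card_le (G.dist u) (s := univ)
    (t := range (Fintype.card V))
    (fun z _ => by
      obtain ⟨q, hq, hql⟩ := hT.connected.exists_path_of_dist u z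
      simpa using hql ▸ hq.length_lt) hsurj (by simp)
  obtain ⟨z, hz⟩ := hdeg
  have hsub : G.dist u '' G.neighborSet z ⊆ {G.dist u z - 1, G.dist u z + 1} := by
    rintro _ ⟨y, hy, rfl⟩
    have := hT.dist_eq_dist_add_one_of_adj u hy
    simp only [Set.mem_insert_iff, Set.mem_singleton_iff]
    omega
  have h1 := Set.ncard_le_ncard hsub
  rw [Set.InjOn.ncard_image (fun a _ b _ h => hinj (by simp) (by simp) h)] at h1
  have h2 := Set.ncard_insert_le (G.dist u z - 1) {G.dist u z + 1}
  rw [Set.ncard_singleton] at h2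
  omega

/-! ### Enumerations of the vertices -/

/-- `x 0, …, x (|V| - 1)` lists every element of `V` exactly once. -/
def IsEnumeration [Fintype V] (x : ℕ → V) : Prop :=
  ∀ v : V, ∃! i : ℕ, i < Fintype.card V ∧ x i = v

lemma IsEnumeration.injOn [Fintype V] {x : ℕ → V} (hx : IsEnumeration x) {i j : ℕ}
    (hi : i < Fintype.card V) (hj : j < Fintype.card V) (h : x i = x j) : i = j :=
  (hx (x j)).unique ⟨hi, h⟩ ⟨hj, rfl⟩

lemma IsEnumeration.sum_range [Fintype V] {x : ℕ → V} (hx : IsEnumeration x) (f : V → ℤ) :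
    ∑ i ∈ range (Fintype.card V), f (x i) = ∑ v, f v := by
  refine sum_nbij x (by simp) ?_ ?_ (by simp)
  · intro i hi j hj h
    exact hx.injOn (by simpa using hi) (by simpa using hj) h
  · intro v _
    obtain ⟨i, ⟨hi, h⟩, -⟩ := hx v
    exact ⟨i, by simpa using hi, h⟩

lemma IsEnumeration.reverse [Fintype V] {x : ℕ → V} (hx : IsEnumeration x) :
    IsEnumeration fun i => x (Fintype.card V - 1 - i) := by
  intro v
  obtain ⟨i, ⟨hi, rfl⟩, huniq⟩ := hx v
  refine ⟨Fintype.card V - 1 - i, ⟨by omega, ?_⟩, ?_⟩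
  · simp only
    congr 1
    omega
  · rintro j ⟨hj, h⟩
    have := huniq _ ⟨by omega, h⟩
    omega

lemma isEnumeration_of_equiv [Fintype V] [Nonempty V] (e : Fin (Fintype.card V) ≃ V) :
    IsEnumeration fun i => if hi : i < Fintype.card V then e ⟨i, hi⟩
      else Classical.arbitrary V := by
  intro v
  refine ⟨e.symm v, ⟨(e.symm v).2, by simp⟩, ?_⟩
  rintro j ⟨hj, h⟩
  simp only [hj, dite_true] at h
  simp [← h]

lemma exists_isEnumeration_monotone [Fintype V] [Nonempty V] (h : V → ℕ) :
    ∃ x : ℕ → V, IsEnumeration x ∧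
      ∀ i j, i ≤ j → j < Fintype.card V → h (x i) ≤ h (x j) := by
  let e := (Fintype.equivFin V).symm
  refine ⟨_, isEnumeration_of_equiv ((Tuple.sort (h ∘ e)).trans e), fun i j hij hj => ?_⟩
  have hi : i < Fintype.card V := by omega
  simpa [hi, hj] using Tuple.monotone_sort (h ∘ e) (show (⟨i, hi⟩ : Fin _) ≤ ⟨j, hj⟩ from hij)

lemma sum_Ico_gap (ℓ g : ℕ → ℤ) (c : ℤ) {i j : ℕ} (hij : i ≤ j) :
    ∑ t ∈ Ico i j, (g (t + 1) - g t - (c - ℓ t - ℓ (t + 1))) =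
      g j - g i - ((j : ℤ) - i) * c + ∑ t ∈ Ico i j, (ℓ t + ℓ (t + 1)) := by
  induction j, hij using Nat.le_induction with
  | base => simp
  | succ j hj ih =>
    rw [sum_Ico_succ_top hj, sum_Ico_succ_top hj, ih]
    push_cast
    ring

lemma sum_Ico_add_succ (ℓ : ℕ → ℤ) (m : ℕ) :
    ∑ t ∈ Ico 0 m, (ℓ t + ℓ (t + 1)) = 2 * ∑ t ∈ range (m + 1), ℓ t - ℓ 0 - ℓ m := by
  induction m with
  | zero => simp; ring
  | succ m ih =>
    rw [sum_Ico_succ_top (Nat.zero_le m), ih, sum_range_succ _ (m + 1)]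
    ring

/-- The total increment of `g` along an enumeration, in terms of the lower bound and of the
excesses of the single increments. -/
lemma IsEnumeration.sum_gap [Fintype V] {G : SimpleGraph V} (hT : G.IsTree) {x : ℕ → V}
    (hx : IsEnumeration x) (g : V → ℤ) :
    ∑ t ∈ Ico 0 (Fintype.card V - 1), (g (x (t + 1)) - g (x t) -
        ((Fintype.card V : ℤ) - 1 - zeta G - detourLevel G (x t) - detourLevel G (x (t + 1)))) =
      g (x (Fintype.card V - 1)) - g (x 0) - lbW G -
        (detourLevel G (x 0) + detourLevel G (x (Fintype.card V - 1)) - zeta' G) := by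
  have := hT.connected.nonempty
  have hcard : 0 < Fintype.card V := Fintype.card_pos
  rw [sum_Ico_gap (fun t => (detourLevel G (x t) : ℤ)) (fun t => g (x t)) _ (Nat.zero_le _),
    sum_Ico_add_succ (fun t => (detourLevel G (x t) : ℤ)), Nat.sub_add_cancel hcard,
    hx.sum_range (fun v => (detourLevel G v : ℤ)), lbW, totalDetourLevel]
  push_cast [Nat.cast_sub hcard]
  ring

/-! ### Spans and hamiltonian colorings -/

lemma dist_le_spanOf [Fintype V] (h : V → ℕ) (u v : V) : Nat.dist (h u) (h v) ≤ spanOf h :=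
  le_csSup (Set.finite_range _).bddAbove ⟨(u, v), rfl⟩

lemma spanOf_le [Nonempty V] {h : V → ℕ} {s : ℕ} (hs : ∀ u v, Nat.dist (h u) (h v) ≤ s) :
    spanOf h ≤ s := by
  refine csSup_le (Set.range_nonempty _) ?_
  rintro _ ⟨p, rfl⟩
  exact hs p.1 p.2

lemma IsEnumeration.spanOf_eq [Fintype V] [Nonempty V] {x : ℕ → V} (hx : IsEnumeration x)
    {h : V → ℕ} (hmono : ∀ i j, i ≤ j → j < Fintype.card V → h (x i) ≤ h (x j)) :
    spanOf h = h (x (Fintype.card V - 1)) - h (x 0) := by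
  have hcard : 0 < Fintype.card V := Fintype.card_pos
  apply le_antisymm
  · have key : ∀ u, h (x 0) ≤ h u ∧ h u ≤ h (x (Fintype.card V - 1)) := by
      intro u
      obtain ⟨i, ⟨hi, rfl⟩, -⟩ := hx u
      exact ⟨hmono _ _ (by omega) hi, hmono _ _ (by omega) (by omega)⟩
    refine spanOf_le fun u v => ?_
    have := key u
    have := key v
    unfold Nat.dist
    omega
  · have := dist_le_spanOf h (x (Fintype.card V - 1)) (x 0)
    unfold Nat.dist at this
    omega

lemma exists_isHamiltonianColoring [Fintype V] (G : SimpleGraph V) :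
    ∃ h : V → ℕ, IsHamiltonianColoring G h := by
  refine ⟨fun v => Fintype.equivFin V v * (Fintype.card V - 1), fun u v huv => ?_⟩
  rw [Nat.dist_mul_right]
  have : (Fintype.equivFin V u : ℕ) ≠ Fintype.equivFin V v := by
    simpa [Fin.val_inj] using huv
  have := Nat.le_mul_of_pos_left (Fintype.card V - 1) (Nat.dist_pos_of_ne this)
  omega

lemma exists_spanOf_eq_hc [Fintype V] (G : SimpleGraph V) :
    ∃ h : V → ℕ, IsHamiltonianColoring G h ∧ spanOf h = hc G := by
  obtain ⟨h, hh⟩ := exists_isHamiltonianColoring G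
  exact Nat.sInf_mem (s := {s | ∃ h : V → ℕ, IsHamiltonianColoring G h ∧ spanOf h = s})
    ⟨_, h, hh, rfl⟩

lemma hc_le_spanOf [Fintype V] {G : SimpleGraph V} {h : V → ℕ}
    (hh : IsHamiltonianColoring G h) : hc G ≤ spanOf h :=
  Nat.sInf_le ⟨h, hh, rfl⟩

/-- Increments of a hamiltonian coloring along a monotone enumeration. -/
lemma IsEnumeration.gap_nonneg [Fintype V] {G : SimpleGraph V} (hT : G.IsTree) {h : V → ℕ}
    (hh : IsHamiltonianColoring G h) {x : ℕ → V} (hx : IsEnumeration x)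
    (hmono : ∀ i j, i ≤ j → j < Fintype.card V → h (x i) ≤ h (x j)) {t : ℕ}
    (ht : t + 1 < Fintype.card V) :
    0 ≤ (h (x (t + 1)) : ℤ) - h (x t) -
      ((Fintype.card V : ℤ) - 1 - zeta G - detourLevel G (x t) - detourLevel G (x (t + 1))) := by
  have hne : x t ≠ x (t + 1) := fun h => by
    have := hx.injOn (by omega) ht h
    omega
  have h1 := hh _ _ hne
  have h2 := hmono t (t + 1) (by omega) ht
  have h3 := dist_le_detourLevel_add hT (x t) (x (t + 1))
  rw [detourDist_eq_dist hT, Nat.dist_eq_sub_of_le h2] at h1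
  omega

lemma IsEnumeration.zeta'_le [Fintype V] {G : SimpleGraph V} (hT : G.IsTree) {x : ℕ → V}
    (hx : IsEnumeration x) (hn : 2 ≤ Fintype.card V) :
    zeta' G ≤ detourLevel G (x 0) + detourLevel G (x (Fintype.card V - 1)) :=
  zeta'_le_detourLevel_add hT fun h => by
    have := hx.injOn (by omega) (by omega) h
    omega

lemma lbW_le_spanOf [Fintype V] {G : SimpleGraph V} (hT : G.IsTree)
    (hn : 2 ≤ Fintype.card V) {h : V → ℕ} (hh : IsHamiltonianColoring G h) :
    lbW G ≤ spanOf h := by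
  have := hT.connected.nonempty
  obtain ⟨x, hx, hmono⟩ := exists_isEnumeration_monotone h
  have h1 := hx.sum_gap hT (fun v => (h v : ℤ))
  have h2 := sum_nonneg (s := Ico 0 (Fintype.card V - 1)) fun t ht =>
    hx.gap_nonneg hT hh hmono (t := t) (by rw [mem_Ico] at ht; omega)
  have h3 := hx.zeta'_le hT hn
  have h4 := hx.spanOf_eq hmono
  have h5 := hmono 0 (Fintype.card V - 1) (by omega) (by omega)
  omega

lemma lbW_le_hc [Fintype V] {G : SimpleGraph V} (hT : G.IsTree) (hn : 2 ≤ Fintype.card V) :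
    lbW G ≤ hc G := by
  obtain ⟨h, hh, hs⟩ := exists_spanOf_eq_hc G
  exact hs ▸ lbW_le_spanOf hT hn hh

/-- A coloring attaining the lower bound has tight increments along a monotone enumeration. -/
lemma IsEnumeration.tight_of_spanOf_eq [Fintype V] {G : SimpleGraph V} (hT : G.IsTree)
    (hn : 2 ≤ Fintype.card V) {h : V → ℕ} (hh : IsHamiltonianColoring G h)
    (hs : (spanOf h : ℤ) = lbW G) {x : ℕ → V} (hx : IsEnumeration x)
    (hmono : ∀ i j, i ≤ j → j < Fintype.card V → h (x i) ≤ h (x j)) :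
    detourLevel G (x 0) + detourLevel G (x (Fintype.card V - 1)) = zeta' G ∧
      ∀ t, t + 1 < Fintype.card V → (h (x (t + 1)) : ℤ) - h (x t) =
        (Fintype.card V : ℤ) - 1 - zeta G - detourLevel G (x t) - detourLevel G (x (t + 1)) := by
  have := hT.connected.nonempty
  have h1 := hx.sum_gap hT (fun v => (h v : ℤ))
  have hgap : ∀ t ∈ Ico 0 (Fintype.card V - 1), _ := fun t ht =>
    hx.gap_nonneg hT hh hmono (t := t) (by rw [mem_Ico] at ht; omega)
  have h2 := sum_nonneg hgap
  have h3 := hx.zeta'_le hT hn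
  have h4 := hx.spanOf_eq hmono
  have h5 := hmono 0 (Fintype.card V - 1) (by omega) (by omega)
  refine ⟨by omega, fun t ht => ?_⟩
  have := (sum_eq_zero_iff_of_nonneg hgap).1 (by omega) t (by rw [mem_Ico]; omega)
  omega

/-- Tight increments turn the coloring condition into the condition on detour distances. -/
lemma detourDist_bound_of_tight [Fintype V] {G : SimpleGraph V} (g : V → ℤ) {x : ℕ → V}
    (htight : ∀ t, t + 1 < Fintype.card V → g (x (t + 1)) - g (x t) =
      (Fintype.card V : ℤ) - 1 - zeta G - detourLevel G (x t) - detourLevel G (x (t + 1)))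
    {i j : ℕ} (hij : i < j) (hj : j ≤ Fintype.card V - 1) :
    (∑ t ∈ Finset.Ico i j, ((detourLevel G (x t) : ℤ) + (detourLevel G (x (t + 1)) : ℤ)))
        - ((j : ℤ) - (i : ℤ)) * ((Fintype.card V : ℤ) - 1 - zeta G)
        + ((Fintype.card V : ℤ) - 1) = (Fintype.card V : ℤ) - 1 - (g (x j) - g (x i)) := by
  have h1 := sum_Ico_gap (fun t => (detourLevel G (x t) : ℤ)) (fun t => g (x t))
    ((Fintype.card V : ℤ) - 1 - zeta G) hij.le
  rw [sum_eq_zero] at h1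
  · linarith
  · intro t ht
    rw [mem_Ico] at ht
    have := htight t (by omega)
    linarith

/-- The data of an ordering as in the characterization of trees attaining the lower bound. -/
structure IsTightOrdering [Fintype V] (G : SimpleGraph V) (x : ℕ → V) : Prop where
  isEnumeration : IsEnumeration x
  sum_endpoints : detourLevel G (x 0) + detourLevel G (x (Fintype.card V - 1)) = zeta' G
  bound : ∀ i j : ℕ, i < j → j ≤ Fintype.card V - 1 →
    (∑ t ∈ Finset.Ico i j, ((detourLevel G (x t) : ℤ) + (detourLevel G (x (t + 1)) : ℤ)))
      - ((j : ℤ) - (i : ℤ)) * ((Fintype.card V : ℤ) - 1 - zeta G)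
      + ((Fintype.card V : ℤ) - 1) ≤ (detourDist G (x i) (x j) : ℤ)

lemma exists_isTightOrdering [Fintype V] {G : SimpleGraph V} (hT : G.IsTree)
    (hn : 2 ≤ Fintype.card V) (hc_eq : (hc G : ℤ) = lbW G) :
    ∃ x : ℕ → V, IsTightOrdering G x ∧ detourLevel G (x 0) = 0 := by
  have := hT.connected.nonempty
  obtain ⟨h, hh, hs⟩ := exists_spanOf_eq_hc G
  obtain ⟨x, hx, hmono⟩ := exists_isEnumeration_monotone h
  obtain ⟨hend, htight⟩ := hx.tight_of_spanOf_eq hT hn hh (by rw [hs, hc_eq]) hmono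
  have hcol : ∀ i j, i < j → j ≤ Fintype.card V - 1 →
      (Fintype.card V : ℤ) - 1 ≤ detourDist G (x i) (x j) + (h (x j) - h (x i)) := by
    intro i j hij hj
    have hne : x i ≠ x j := fun h => by
      have := hx.injOn (by omega) (by omega) h
      omega
    have h1 := hh _ _ hne
    have h2 := hmono i j hij.le (by omega)
    rw [Nat.dist_eq_sub_of_le h2] at h1
    omega
  by_cases h0 : detourLevel G (x 0) = 0
  · refine ⟨x, ⟨hx, hend, fun i j hij hj => ?_⟩, h0⟩
    rw [detourDist_bound_of_tight (fun v => (h v : ℤ)) htight hij hj]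
    linarith [hcol i j hij hj]
  · have hz : zeta' G ≤ 1 := Nat.sub_le _ _
    refine ⟨_, ⟨hx.reverse, ?_, fun i j hij hj => ?_⟩, ?_⟩
    · rw [Nat.sub_zero, Nat.sub_self, add_comm, hend]
    · rw [detourDist_bound_of_tight (fun v => -(h v : ℤ)) (fun t ht => ?_) hij hj]
      · have h1 := hcol (Fintype.card V - 1 - j) (Fintype.card V - 1 - i) (by omega) (by omega)
        rw [detourDist_eq_dist hT, dist_comm, ← detourDist_eq_dist hT] at h1
        linarith
      · have h1 := htight (Fintype.card V - 1 - (t + 1)) (by omega)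
        rw [show Fintype.card V - 1 - (t + 1) + 1 = Fintype.card V - 1 - t by omega] at h1
        linarith
    · rw [Nat.sub_zero]
      omega

/-- The coloring defined recursively from a tight ordering is hamiltonian and attains the
lower bound. -/
lemma IsTightOrdering.isHamiltonianColoring [Fintype V] {G : SimpleGraph V} (hT : G.IsTree)
    (hdeg : ∃ v, 3 ≤ (G.neighborSet v).ncard) {x : ℕ → V} (hx : IsTightOrdering G x)
    {h : V → ℕ} (htight : ∀ t, t + 1 < Fintype.card V → (h (x (t + 1)) : ℤ) - h (x t) =
      (Fintype.card V : ℤ) - 1 - zeta G - detourLevel G (x t) - detourLevel G (x (t + 1))) :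
    IsHamiltonianColoring G h ∧ (spanOf h : ℤ) = lbW G := by
  have := hT.connected.nonempty
  have hstep : ∀ t, t + 1 < Fintype.card V → h (x t) ≤ h (x (t + 1)) := by
    intro t ht
    have h1 := hx.bound t (t + 1) (by omega) (by omega)
    rw [detourDist_bound_of_tight (fun v => (h v : ℤ)) htight (by omega) (by omega),
      detourDist_eq_dist hT] at h1
    have h2 := dist_add_one_lt_card hT hdeg (x t) (x (t + 1))
    omega
  have hmono : ∀ i j, i ≤ j → j < Fintype.card V → h (x i) ≤ h (x j) := by
    intro i j hij
    induction j, hij using Nat.le_induction with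
    | base => exact fun _ => le_rfl
    | succ j hj ih => exact fun hlt => (ih (by omega)).trans (hstep j hlt)
  refine ⟨?_, ?_⟩
  · have key : ∀ i j, i < j → j < Fintype.card V →
        Fintype.card V - 1 ≤ detourDist G (x i) (x j) + Nat.dist (h (x i)) (h (x j)) := by
      intro i j hij hj
      have h1 := hx.bound i j hij (by omega)
      rw [detourDist_bound_of_tight (fun v => (h v : ℤ)) htight hij (by omega)] at h1
      have h2 := hmono i j hij.le hj
      rw [Nat.dist_eq_sub_of_le h2]
      omega
    intro u v huv
    obtain ⟨i, ⟨hi, rfl⟩, -⟩ := hx.isEnumeration u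
    obtain ⟨j, ⟨hj, rfl⟩, -⟩ := hx.isEnumeration v
    rcases lt_trichotomy i j with hij | rfl | hij
    · exact key i j hij hj
    · exact absurd rfl huv
    · rw [Nat.dist_comm, detourDist_eq_dist hT, dist_comm, ← detourDist_eq_dist hT]
      exact key j i hij hi
  · have hcard : 0 < Fintype.card V := Fintype.card_pos
    have h1 := hx.isEnumeration.sum_gap hT (fun v => (h v : ℤ))
    rw [sum_eq_zero] at h1
    · have h2 := hx.isEnumeration.spanOf_eq hmono
      have h3 := hmono 0 (Fintype.card V - 1) (by omega) (by omega)
      have h4 := hx.sum_endpoints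
      omega
    · intro t ht
      rw [mem_Ico] at ht
      have := htight t (by omega)
      linarith

/-- Every tight ordering comes from a natural-valued coloring satisfying the recursion. -/
lemma IsTightOrdering.exists_coloring [Fintype V] {G : SimpleGraph V} (hT : G.IsTree)
    {x : ℕ → V} (hx : IsTightOrdering G x) :
    ∃ h : V → ℕ, ∀ t, t + 1 < Fintype.card V → (h (x (t + 1)) : ℤ) - h (x t) =
      (Fintype.card V : ℤ) - 1 - zeta G - detourLevel G (x t) - detourLevel G (x (t + 1)) := by
  let a : ℕ → ℕ := fun t =>
    Fintype.card V - 1 - zeta G - detourLevel G (x t) - detourLevel G (x (t + 1))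
  choose idx hidx using fun v => (hx.isEnumeration v).exists
  have hidx' : ∀ t, t < Fintype.card V → idx (x t) = t := fun t ht =>
    hx.isEnumeration.injOn (hidx _).1 ht (hidx _).2
  refine ⟨fun v => ∑ t ∈ range (idx v), a t, fun t ht => ?_⟩
  have h1 := hx.bound t (t + 1) (by omega) (by omega)
  obtain ⟨p, hp, hl⟩ := hT.connected.exists_path_of_dist (x t) (x (t + 1))
  have h2 := hp.length_lt
  rw [detourDist_eq_dist hT, ← hl] at h1
  simp only [Nat.Ico_succ_singleton, sum_singleton, Nat.cast_add, Nat.cast_one,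
    add_sub_cancel_left, one_mul] at h1
  have h3 : (a t : ℤ) = (Fintype.card V : ℤ) - 1 - zeta G - detourLevel G (x t) -
      detourLevel G (x (t + 1)) := by
    simp only [a]
    omega
  simp only [hidx' t (by omega), hidx' (t + 1) ht, sum_range_succ]
  push_cast
  rw [h3]
  ring

/-- `hc(T)` attains the lower bound iff a suitable vertex ordering exists; moreover the
coloring defined from such an ordering is an optimal hamiltonian coloring. -/
theorem stmt6 [Fintype V] {G : SimpleGraph V} (hT : G.IsTree)
    (hn : 4 ≤ Fintype.card V) (hdeg : ∃ v, 3 ≤ (G.neighborSet v).ncard) :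
    (((hc G : ℤ) = lbW G) ↔
      ∃ x : ℕ → V, (∀ v : V, ∃! i : ℕ, i < Fintype.card V ∧ x i = v) ∧
        ((WeightCenters G).ncard = 1 →
          detourLevel G (x 0) = 0 ∧ detourLevel G (x (Fintype.card V - 1)) = 1) ∧
        ((WeightCenters G).ncard = 2 →
          detourLevel G (x 0) = 0 ∧ detourLevel G (x (Fintype.card V - 1)) = 0) ∧
        (∀ i j : ℕ, i < j → j ≤ Fintype.card V - 1 →
          (∑ t ∈ Finset.Ico i j,
              ((detourLevel G (x t) : ℤ) + (detourLevel G (x (t + 1)) : ℤ)))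
            - ((j : ℤ) - (i : ℤ)) * ((Fintype.card V : ℤ) - 1 - zeta G)
            + ((Fintype.card V : ℤ) - 1) ≤ (detourDist G (x i) (x j) : ℤ))) ∧
    (∀ x : ℕ → V, (∀ v : V, ∃! i : ℕ, i < Fintype.card V ∧ x i = v) →
      ((WeightCenters G).ncard = 1 →
        detourLevel G (x 0) = 0 ∧ detourLevel G (x (Fintype.card V - 1)) = 1) →
      ((WeightCenters G).ncard = 2 →
        detourLevel G (x 0) = 0 ∧ detourLevel G (x (Fintype.card V - 1)) = 0) →
      (∀ i j : ℕ, i < j → j ≤ Fintype.card V - 1 →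
          (∑ t ∈ Finset.Ico i j,
              ((detourLevel G (x t) : ℤ) + (detourLevel G (x (t + 1)) : ℤ)))
            - ((j : ℤ) - (i : ℤ)) * ((Fintype.card V : ℤ) - 1 - zeta G)
            + ((Fintype.card V : ℤ) - 1) ≤ (detourDist G (x i) (x j) : ℤ)) →
      ∀ h : V → ℕ, h (x 0) = 0 →
        (∀ i : ℕ, i + 1 ≤ Fintype.card V - 1 →
          (h (x (i + 1)) : ℤ) = (h (x i) : ℤ) + (Fintype.card V : ℤ) - 1 - zeta G
            - detourLevel G (x i) - detourLevel G (x (i + 1))) →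
        IsHamiltonianColoring G h ∧ spanOf h = hc G) := by
  have hends : ∀ x : ℕ → V,
      ((WeightCenters G).ncard = 1 →
        detourLevel G (x 0) = 0 ∧ detourLevel G (x (Fintype.card V - 1)) = 1) →
      ((WeightCenters G).ncard = 2 →
        detourLevel G (x 0) = 0 ∧ detourLevel G (x (Fintype.card V - 1)) = 0) →
      detourLevel G (x 0) + detourLevel G (x (Fintype.card V - 1)) = zeta' G := by
    intro x h1 h2
    rcases zeta_cases hT with ⟨h, -, hz⟩ | ⟨h, -, hz⟩
    · have := h1 h
      omega
    · have := h2 h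
      omega
  have hopt : ∀ x : ℕ → V, IsTightOrdering G x → ∀ h : V → ℕ,
      (∀ t, t + 1 < Fintype.card V → (h (x (t + 1)) : ℤ) - h (x t) =
        (Fintype.card V : ℤ) - 1 - zeta G - detourLevel G (x t) - detourLevel G (x (t + 1))) →
      IsHamiltonianColoring G h ∧ spanOf h = hc G ∧ (hc G : ℤ) = lbW G := by
    intro x hx h htight
    obtain ⟨hh, hs⟩ := hx.isHamiltonianColoring hT hdeg htight
    have h1 := hc_le_spanOf hh
    have h2 := lbW_le_hc hT (by omega)
    exact ⟨hh, by omega, by omega⟩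
  refine ⟨⟨fun hc_eq => ?_, ?_⟩, ?_⟩
  · obtain ⟨x, hx, h0⟩ := exists_isTightOrdering hT (by omega) hc_eq
    have hend := hx.sum_endpoints
    refine ⟨x, hx.isEnumeration, ?_, ?_, hx.bound⟩ <;> intro hcard <;>
      rcases zeta_cases hT with ⟨h, -, hz⟩ | ⟨h, -, hz⟩ <;> omega
  · rintro ⟨x, hx, h1, h2, hbound⟩
    have hx' : IsTightOrdering G x := ⟨hx, hends x h1 h2, hbound⟩
    obtain ⟨h, htight⟩ := hx'.exists_coloring hT
    exact (hopt x hx' h htight).2.2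
  · intro x hx h1 h2 hbound h _ hrec
    obtain ⟨hh, hs, -⟩ := hopt x ⟨hx, hends x h1 h2, hbound⟩ h fun t ht => by
      have := hrec t (by omega)
      omega
    exact ⟨hh, hs⟩

end HCPaper
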